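/- Let (R, m) be an F-finite regular local ring of characteristic p > 0, q = p^e, and f ∈ R with ν^{(q)}(f) := sup{n : f ∈ R^q + m^n} finite, written ν^{(q)}(f) = qa + b with 0 ≤ b < q. Then ν^{(q)}(f) ≤ η(f) < q(a+1), where η(f) = min_{1 ≤ i ≤ q−1}( ν(Diff_{R,+}^i(f)) + i ). -/

import Mathlib

/-- `IsDiffOp R n D` : `D` is an (absolute) differential operator of `R` of order at most `n`,
defined inductively: order `≤ 0` means `R`-linear, and `D` has order `≤ n+1` if all the
commutators `[D, mulLeft r]` have order `≤ n`.  (For commutative rings this agrees with the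
definition via the left `R`-linear extension of `D` to `R ⊗ R` annihilating `T_R^{n+1}`.) -/
def IsDiffOp (R : Type*) [CommRing R] : ℕ → (R →+ R) → Prop
  | 0, D => ∀ r s : R, D (r * s) = r * D s
  | n + 1, D => ∀ r : R,
      IsDiffOp R n ((D.comp (AddMonoidHom.mulLeft r)) - ((AddMonoidHom.mulLeft r).comp D))


/-- A Noetherian local ring is regular when its maximal ideal is generated by a regular
sequence. -/
def IsRegularLocal (R : Type*) [CommRing R] [IsLocalRing R] : Prop :=
  IsNoetherianRing R ∧ ∃ rs : List R,
    RingTheory.Sequence.IsRegular R rs ∧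
    Ideal.span {x | x ∈ rs} = IsLocalRing.maximalIdeal R

/-- The `q`-order `ν^{(q)}(f) = sup {n : f ∈ R^q + m^n}` (as an extended natural). -/
noncomputable def nuQ (R : Type*) [CommRing R] [IsLocalRing R] (q : ℕ) (f : R) : ℕ∞ :=
  sSup {n : ℕ∞ | ∃ m : ℕ, n = (m : ℕ∞) ∧
    ∃ lam : R, f - lam ^ q ∈ IsLocalRing.maximalIdeal R ^ m}

/-- The order `ν(I) = sup {n : I ⊆ m^n}` of an ideal at the local ring. -/
noncomputable def ordIdeal (R : Type*) [CommRing R] [IsLocalRing R] (I : Ideal R) : ℕ∞ :=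
  sSup {n : ℕ∞ | ∃ m : ℕ, n = (m : ℕ∞) ∧ I ≤ IsLocalRing.maximalIdeal R ^ m}

/-- The ideal `Diff_{R,+}^i(f)` generated by evaluations on `f` of differential operators
of order at most `i` annihilating `1`. -/
def diffIdealPlus (R : Type*) [CommRing R] (i : ℕ) (f : R) : Ideal R :=
  Ideal.span {y : R | ∃ D : R →+ R, IsDiffOp R i D ∧ D 1 = 0 ∧ D f = y}

/-- `η(f) = min_{1 ≤ i ≤ q-1} ( ν(Diff_{R,+}^i(f)) + i )`. -/
noncomputable def etaF (R : Type*) [CommRing R] [IsLocalRing R] (q : ℕ) (f : R) : ℕ∞ :=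
  ⨅ i ∈ Finset.Icc 1 (q - 1), (ordIdeal R (diffIdealPlus R i f) + (i : ℕ∞))

theorem qr_weight_one {σ : Type*} (s : σ →₀ ℕ) : Finsupp.weight (1 : σ → ℕ) s = s.degree := by
  rw [Finsupp.degree_eq_weight_one]; rfl

open MvPolynomial in
theorem qr_eval_mem {R : Type*} [CommRing R] {d n : ℕ} (x : Fin d → R) (J : Ideal R)
    (F : MvPolynomial (Fin d) R) (hF : F.IsHomogeneous n) (hJ : ∀ s, coeff s F ∈ J) :
    eval x F ∈ J * Ideal.span (Set.range x) ^ n := by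
  rw [eval_eq']
  refine Ideal.sum_mem _ fun s hs => ?_
  refine Ideal.mul_mem_mul (hJ s) ?_
  have h1 : s.degree = n := by
    have := hF (mem_support_iff.1 hs)
    rwa [qr_weight_one] at this
  have h2 : ∑ i, s i = n := by rw [← h1, Finsupp.degree_eq_sum]
  rw [← h2, ← Finset.prod_pow_eq_pow_sum]
  exact Ideal.prod_mem_prod fun i _ => Ideal.pow_mem_pow (Ideal.subset_span (Set.mem_range_self i)) _

open MvPolynomial in
theorem qr_exists {R : Type*} [CommRing R] {d n : ℕ} (x : Fin d → R) (J : Ideal R) (y : R)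
    (hy : y ∈ J * Ideal.span (Set.range x) ^ n) :
    ∃ F : MvPolynomial (Fin d) R, F.IsHomogeneous n ∧ (∀ s, coeff s F ∈ J) ∧ eval x F = y := by
  induction hy using Submodule.mul_induction_on' with
  | mem_mul_mem a ha b hb =>
    obtain ⟨G, hG, rfl⟩ := (Ideal.mem_span_pow_iff_exists_isHomogeneous x b).1 hb
    refine ⟨C a * G, by simpa using (isHomogeneous_C (Fin d) a).mul hG, fun s => ?_, by simp⟩
    rw [coeff_C_mul]; exact J.mul_mem_right _ ha
  | add a ha b hb h1 h2 =>
    obtain ⟨F, hF, hF1, rfl⟩ := h1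
    obtain ⟨G, hG, hG1, rfl⟩ := h2
    exact ⟨F + G, hF.add hG, fun s => by rw [coeff_add]; exact J.add_mem (hF1 s) (hG1 s), by simp⟩

open MvPolynomial in
theorem qr_red {R : Type*} [CommRing R] {d n : ℕ} (x : Fin d → R)
    (h : ∀ F : MvPolynomial (Fin d) R, F.IsHomogeneous n → eval x F = 0 →
      ∀ s, coeff s F ∈ Ideal.span (Set.range x))
    (F : MvPolynomial (Fin d) R) (hF : F.IsHomogeneous n)
    (hx : eval x F ∈ Ideal.span (Set.range x) ^ (n + 1)) (s) :
    coeff s F ∈ Ideal.span (Set.range x) := by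
  rw [pow_succ'] at hx
  obtain ⟨G, hG, hG1, hG2⟩ := qr_exists x _ _ hx
  have := h (F - G) (hF.sub hG) (by simp [hG2]) s
  rw [coeff_sub] at this
  simpa using Ideal.add_mem _ this (hG1 s)

open MvPolynomial in
theorem qr_main {R : Type*} [CommRing R] : ∀ (d : ℕ) (x : Fin d → R)
    (_ : ∀ i y, x i * y ∈ Ideal.span (x '' {j | i < j}) → y ∈ Ideal.span (x '' {j | i < j}))
    (n : ℕ) (F : MvPolynomial (Fin d) R) (_ : F.IsHomogeneous n) (_ : eval x F = 0) (s),
      coeff s F ∈ Ideal.span (Set.range x) := by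
  intro d
  induction d with
  | zero =>
    intro x _ n F _ h0 s
    obtain ⟨c, rfl⟩ := C_surjective (R := R) (Fin 0) F
    simp at h0
    simp [h0]
  | succ d ih =>
    intro x hx
    set x' : Fin d → R := fun i => x i.succ with hx'
    set I := Ideal.span (Set.range x) with hI
    set I' := Ideal.span (Set.range x') with hI'
    have hle : I' ≤ I := Ideal.span_mono (by rintro _ ⟨i, rfl⟩; exact ⟨i.succ, rfl⟩)
    have hx0 : x 0 ∈ I := Ideal.subset_span ⟨0, rfl⟩
    have himg : x '' {j | 0 < j} = Set.range x' := by
      ext y; constructor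
      · rintro ⟨j, hj, rfl⟩
        obtain ⟨k, rfl⟩ := Fin.exists_succ_eq.2 (ne_of_gt hj)
        exact ⟨k, rfl⟩
      · rintro ⟨k, rfl⟩; exact ⟨k.succ, Fin.succ_pos k, rfl⟩
    have hreg0 : ∀ y, x 0 * y ∈ I' → y ∈ I' := by
      intro y hy
      have := hx 0 y
      rw [himg] at this; exact this hy
    have ih' := ih x' (by
      intro i y
      have := hx i.succ y
      have e : x '' {j | i.succ < j} = x' '' {j | i < j} := by
        ext y; constructor
        · rintro ⟨j, hj, rfl⟩
          obtain ⟨k, rfl⟩ := Fin.exists_succ_eq.2 (ne_of_gt (lt_of_le_of_lt (Fin.zero_le _) hj))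
          exact ⟨k, by simpa using hj, rfl⟩
        · rintro ⟨k, hk, rfl⟩; exact ⟨k.succ, by simpa using hk, rfl⟩
      rw [e] at this; exact this)
    have stepA : ∀ j y, x 0 * y ∈ I' ^ j → y ∈ I' ^ j := by
      intro j
      induction j with
      | zero => simp
      | succ j ihj =>
        intro y hy
        have hy1 := ihj y (Ideal.pow_le_pow_right (Nat.le_succ j) hy)
        obtain ⟨G, hG, rfl⟩ := (Ideal.mem_span_pow_iff_exists_isHomogeneous x' y).1 hy1
        have h2 := qr_red x' (ih' j) (C (x 0) * G)
          (by simpa using (isHomogeneous_C (Fin d) (x 0)).mul hG) (by simpa using hy)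
        rw [pow_succ']
        exact qr_eval_mem x' I' G hG fun s => hreg0 _ (by simpa using h2 s)
    intro n
    induction n with
    | zero =>
      intro F hF h0 s
      have hF0 := totalDegree_eq_zero_iff_eq_C.1 ((totalDegree_zero_iff_isHomogeneous _).2 hF)
      rw [hF0] at h0
      simp only [eval_C] at h0
      rw [hF0, h0]; simp
    | succ n ihn =>
      intro F hF h0 s
      set Q := finSuccEquiv R d F with hQ
      set G := Q.coeff 0 with hGd
      set H := (finSuccEquiv R d).symm Q.divX with hHd
      have cG : ∀ m, coeff m G = coeff (m.cons 0) F := fun m => by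
        rw [hGd, hQ, finSuccEquiv_coeff_coeff]
      have cH : ∀ i m, coeff (Finsupp.cons i m) H = coeff (Finsupp.cons (i+1) m) F := fun i m => by
        rw [← finSuccEquiv_coeff_coeff, hHd, AlgEquiv.apply_symm_apply, Polynomial.coeff_divX,
          hQ, finSuccEquiv_coeff_coeff]
      have dcons : ∀ (i : ℕ) (m : Fin d →₀ ℕ), (Finsupp.cons i m).degree = i + m.degree := by
        intro i m
        simp [Finsupp.degree_eq_sum, Fin.sum_univ_succ]
      have hG : G.IsHomogeneous (n+1) := by
        intro m hm
        rw [cG] at hm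
        have := hF hm
        rw [qr_weight_one] at this ⊢
        rw [dcons] at this
        simpa using this
      have hH : H.IsHomogeneous n := by
        intro m hm
        rw [← Finsupp.cons_tail m, cH] at hm
        have := hF hm
        rw [qr_weight_one] at this ⊢
        rw [← Finsupp.cons_tail m]
        rw [dcons] at this ⊢
        omega
      have hxc : x = Fin.cons (x 0) x' := by
        funext i; refine Fin.cases ?_ (fun j => ?_) i <;> simp [hx']
      have hev : eval x F = eval x' G + x 0 * eval x H := by
        rw [hxc]
        rw [eval_eq_eval_mv_eval', eval_eq_eval_mv_eval', hHd, AlgEquiv.apply_symm_apply, ← hQ]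
        conv_lhs => rw [← Polynomial.divX_mul_X_add Q]
        simp [hGd]; ring
      have hGm : eval x' G ∈ I' ^ (n+1) :=
        (Ideal.mem_span_pow_iff_exists_isHomogeneous x' _).2 ⟨G, hG, rfl⟩
      have hHm : eval x H ∈ I' ^ (n+1) := by
        apply stepA
        have : x 0 * eval x H = - eval x' G := by
          rw [eq_neg_iff_add_eq_zero, add_comm, ← hev, h0]
        rw [this]; exact neg_mem hGm
      have hHc := qr_red x ihn H hH (Ideal.pow_right_mono hle _ hHm)
      obtain ⟨h, hh, hhe⟩ := (Ideal.mem_span_pow_iff_exists_isHomogeneous x' _).1 hHm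
      have hGc := ih' (n+1) (G + C (x 0) * h)
        (hG.add (by simpa using (isHomogeneous_C (Fin d) (x 0)).mul hh))
        (by simp [hhe, ← hev, h0])
      rw [← Finsupp.cons_tail s]
      cases hs : s 0 with
      | zero =>
        rw [← cG]
        have := hle (hGc s.tail)
        rw [coeff_add, coeff_C_mul] at this
        exact (Ideal.add_mem_iff_left _ (I.mul_mem_right _ hx0)).1 this
      | succ i => rw [← cH]; exact hHc _

universe u
theorem pb_step {K L : Type u} [Field K] [Field L] [Algebra K L] [FiniteDimensional K L]
    (p : ℕ) [Fact p.Prime] [CharP L p] (h : ∀ y : L, y ^ p ∈ (algebraMap K L).range)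
    (w : L) (hw : w ∉ (algebraMap K L).range) :
    ∃ B : Module.Basis (Fin p) K (IntermediateField.adjoin K {w}), ∀ j, (B j : L) = w ^ (j : ℕ) := by
  obtain ⟨a, ha⟩ := h w
  have hp : p.Prime := Fact.out
  have hirr : Irreducible (Polynomial.X ^ p - Polynomial.C a) := by
    apply X_pow_sub_C_irreducible_of_prime hp
    intro b hb
    apply hw
    refine ⟨b, ?_⟩
    apply frobenius_inj L p
    simp only [frobenius_def]
    rw [← map_pow, hb, ha]
  have hmin : minpoly K w = Polynomial.X ^ p - Polynomial.C a := by
    symm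
    apply minpoly.eq_of_irreducible_of_monic hirr
    · simp [ha]
    · exact Polynomial.monic_X_pow_sub_C a hp.ne_zero
  have hwint : IsIntegral K w := Algebra.IsIntegral.isIntegral w
  have hdim : (IntermediateField.adjoin.powerBasis hwint).dim = p := by
    rw [IntermediateField.adjoin.powerBasis_dim, hmin, Polynomial.natDegree_X_pow_sub_C]
  refine ⟨(IntermediateField.adjoin.powerBasis hwint).basis.reindex (finCongr hdim), fun j => ?_⟩
  simp [PowerBasis.coe_basis]

theorem pb_exists {L : Type u} [Field L] (p : ℕ) [Fact p.Prime] [CharP L p] : ∀ (n : ℕ)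
    (K : Type u) [Field K] [Algebra K L] [FiniteDimensional K L]
    (_ : ∀ y : L, y ^ p ∈ (algebraMap K L).range) (_ : Module.finrank K L = n),
    ∃ (r : ℕ) (u : Fin r → L) (B : Module.Basis (Fin r → Fin p) K L),
      ∀ β, B β = ∏ i, u i ^ (β i : ℕ) := by
  intro n
  induction n using Nat.strong_induction_on with
  | _ n ih =>
    intro K _ _ _ h hn
    by_cases htop : ∀ y : L, y ∈ (algebraMap K L).range
    · refine ⟨0, Fin.elim0, ?_⟩
      have hone : Module.finrank K L = 1 := by
        rw [finrank_eq_one_iff_of_nonzero' (1 : L) one_ne_zero]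
        intro y
        obtain ⟨c, hc⟩ := htop y
        exact ⟨c, by rw [← hc, Algebra.smul_def, mul_one]⟩
      refine ⟨Module.Basis.mk (v := fun _ : Fin 0 → Fin p => (1 : L))
        (linearIndependent_unique_iff.2 one_ne_zero) ?_, ?_⟩
      swap
      · intro β; rw [Module.Basis.mk_apply]; simp
      intro y _
      obtain ⟨c, hc⟩ := htop y
      rw [← hc, Algebra.algebraMap_eq_smul_one]
      exact Submodule.smul_mem _ _ (Submodule.subset_span ⟨default, rfl⟩)
    · push Not at htop
      obtain ⟨w, hw⟩ := htop
      obtain ⟨B, hB⟩ := pb_step (K := K) p h w hw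
      have hmul := Module.finrank_mul_finrank K (IntermediateField.adjoin K {w}) L
      have hE : Module.finrank K (IntermediateField.adjoin K {w}) = p := by
        rw [Module.finrank_eq_card_basis B]; simp
      have hpos : 0 < Module.finrank (IntermediateField.adjoin K {w}) L := Module.finrank_pos
      have hp : p.Prime := Fact.out
      obtain ⟨r, v, B', hB'⟩ := ih (Module.finrank (IntermediateField.adjoin K {w}) L)
        (by rw [← hn, ← hmul, hE]; nlinarith [hp.two_le]) (IntermediateField.adjoin K {w})
        (by
          intro y
          obtain ⟨a, ha⟩ := h y
          exact ⟨algebraMap K _ a, by rw [← ha]; rfl⟩) rfl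
      refine ⟨r + 1, Fin.cons w v, (B.smulTower B').reindex (Fin.consEquiv (fun _ => Fin p)), ?_⟩
      intro β
      rw [Module.Basis.reindex_apply, Module.Basis.smulTower_apply, hB', Fin.prod_univ_succ]
      simp only [Fin.cons_zero, Fin.cons_succ]
      rw [IntermediateField.smul_def, hB, smul_eq_mul]
      rfl

theorem pb_finite (R : Type u) [CommRing R] [IsLocalRing R]
    (p : ℕ) [Fact p.Prime] [CharP R p] [CharP (IsLocalRing.ResidueField R) p]
    (hF : Module.Finite (↥(frobenius R p).range) R) :
    Module.Finite (frobenius (IsLocalRing.ResidueField R) p).fieldRange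
      (IsLocalRing.ResidueField R) := by
  obtain ⟨S, hS⟩ := hF.fg_top
  classical
  refine ⟨⟨S.image (IsLocalRing.residue R), ?_⟩⟩
  rw [eq_top_iff]
  intro y _
  obtain ⟨y, rfl⟩ := IsLocalRing.residue_surjective y
  have hy : y ∈ Submodule.span (frobenius R p).range (S : Set R) := by rw [hS]; trivial
  induction hy using Submodule.span_induction with
  | mem z hz =>
    exact Submodule.subset_span (by simpa using ⟨z, hz, rfl⟩)
  | zero => simp
  | add a b _ _ ha hb => rw [map_add]; exact Submodule.add_mem _ (ha trivial) (hb trivial)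
  | smul a b _ hb =>
    obtain ⟨a, t, rfl⟩ := a
    have : IsLocalRing.residue R ((⟨frobenius R p t, t, rfl⟩ : (frobenius R p).range) • b)
      = (⟨frobenius _ p (IsLocalRing.residue R t), _, rfl⟩ :
          (frobenius (IsLocalRing.ResidueField R) p).fieldRange) • IsLocalRing.residue R b := by
      rw [Subring.smul_def, Subfield.smul_def]
      simp [frobenius_def]
    rw [this]
    exact Submodule.smul_mem _ _ (hb trivial)

theorem pb_local (R : Type u) [CommRing R] [IsLocalRing R]
    (p : ℕ) [Fact p.Prime] [CharP R p]
    (hF : Module.Finite (↥(frobenius R p).range) R) :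
    ∃ (r : ℕ) (v : Fin r → R),
      (∀ y, ∃ c : (Fin r → Fin p) → R,
        y - ∑ β, c β ^ p * ∏ i, v i ^ (β i : ℕ) ∈ IsLocalRing.maximalIdeal R) ∧
      (∀ c : (Fin r → Fin p) → R,
        ∑ β, c β ^ p * ∏ i, v i ^ (β i : ℕ) ∈ IsLocalRing.maximalIdeal R →
        ∀ β, c β ∈ IsLocalRing.maximalIdeal R) := by
  have hp : p.Prime := Fact.out
  have : CharP (IsLocalRing.ResidueField R) p := by
    apply (CharP.charP_iff_prime_eq_zero hp).2
    rw [← map_natCast (IsLocalRing.residue R), CharP.cast_eq_zero, map_zero]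
  have := pb_finite R p hF
  obtain ⟨r, u, B, hB⟩ := pb_exists (L := IsLocalRing.ResidueField R) p _
    (frobenius (IsLocalRing.ResidueField R) p).fieldRange
    (fun y => ⟨⟨frobenius _ p y, y, rfl⟩, rfl⟩) rfl
  choose v hv using fun i => IsLocalRing.residue_surjective (u i)
  refine ⟨r, v, fun y => ?_, fun c hc β => ?_⟩
  · have h1 := B.sum_repr (IsLocalRing.residue R y)
    choose c hc using fun β => (B.repr (IsLocalRing.residue R y) β).2
    choose c' hc' using fun β => IsLocalRing.residue_surjective (c β)
    refine ⟨c', ?_⟩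
    rw [← IsLocalRing.residue_eq_zero_iff, map_sub, sub_eq_zero, ← h1, map_sum]
    refine Finset.sum_congr rfl fun β _ => ?_
    rw [Subfield.smul_def, ← hc, hB]
    simp [hc', hv, frobenius_def]
  · have hli := Fintype.linearIndependent_iff.1 B.linearIndependent
      (fun β => ⟨frobenius _ p (IsLocalRing.residue R (c β)), _, rfl⟩) (by
        rw [← IsLocalRing.residue_eq_zero_iff, map_sum] at hc
        rw [← hc]
        refine Finset.sum_congr rfl fun β _ => ?_
        rw [Subfield.smul_def, hB]
        simp [hv, frobenius_def]) β
    rw [← IsLocalRing.residue_eq_zero_iff]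
    have := congrArg Subtype.val hli
    simpa [frobenius_def, hp.ne_zero] using this

open MvPolynomial in
theorem kp_pow {R : Type*} [CommRing R] (p : ℕ) [Fact p.Prime] [CharP R p] {σ : Type*}
    (P : MvPolynomial σ R) : P ^ p = expand p (map (frobenius R p) P) := by
  have : (frobenius (MvPolynomial σ R) p) =
      ((expand p : MvPolynomial σ R →ₐ[R] MvPolynomial σ R) : _ →+* _).comp
        (map (frobenius R p)) := by
    apply MvPolynomial.ringHom_ext
    · intro r; simp [frobenius_def]
    · intro i; simp [frobenius_def]
  have h := RingHom.congr_fun this P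
  simpa [frobenius_def] using h

open MvPolynomial in
theorem kp_coeff_same {R : Type*} [CommRing R] (p : ℕ) [hp : Fact p.Prime] [CharP R p] {σ : Type*}
    (P : MvPolynomial σ R) (a δ : σ →₀ ℕ) (r : R) :
    coeff (p • δ + a) (monomial a r * P ^ p) = r * coeff δ P ^ p := by
  rw [add_comm, coeff_monomial_mul, kp_pow, coeff_expand_smul _ hp.out.ne_zero, coeff_map,
    frobenius_def]

open MvPolynomial in
theorem kp_coeff_ne {R : Type*} [CommRing R] (p : ℕ) [hp : Fact p.Prime] [CharP R p] {σ : Type*}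
    (P : MvPolynomial σ R) (a a' δ : σ →₀ ℕ) (r : R) (ha : ∀ i, a i < p) (ha' : ∀ i, a' i < p)
    (hne : a' ≠ a) :
    coeff (p • δ + a) (monomial a' r * P ^ p) = 0 := by
  classical
  rw [coeff_monomial_mul']
  split_ifs with hle
  · by_cases h0 : coeff (p • δ + a - a') (P ^ p) = 0
    · rw [h0, mul_zero]
    · exfalso
      rw [kp_pow, ← ne_eq, ← mem_support_iff] at h0
      have := support_expand_subset _ h0
      obtain ⟨m, -, hm⟩ := Finset.mem_image.1 this
      apply hne
      ext i
      have h1 := DFunLike.congr_fun hm i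
      have h2 := hle i
      simp only [Finsupp.smul_apply, Finsupp.tsub_apply, Finsupp.add_apply, smul_eq_mul] at h1 h2
      have h3 : p * m i + a' i = p * δ i + a i := by omega
      have h4 := congrArg (· % p) h3
      simpa [Nat.mul_add_mod, Nat.mod_eq_of_lt (ha i), Nat.mod_eq_of_lt (ha' i)] using h4
  · rfl

theorem kp_prod_mem {R : Type*} [CommRing R] {d : ℕ} (x : Fin d → R) (m : Ideal R)
    (hx : ∀ i, x i ∈ m) (α : Fin d → ℕ) : ∏ i, x i ^ α i ∈ m ^ (∑ i, α i) := by
  rw [← Finset.prod_pow_eq_pow_sum]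
  exact Ideal.prod_mem_prod fun i _ => Ideal.pow_mem_pow (hx i) _

open MvPolynomial in
theorem kp_main {R : Type*} [CommRing R] (p : ℕ) [hp : Fact p.Prime] [CharP R p] {d r : ℕ}
    (m : Ideal R) (x : Fin d → R) (hxm : Ideal.span (Set.range x) = m)
    (hqr : ∀ (n : ℕ) (F : MvPolynomial (Fin d) R), F.IsHomogeneous n → eval x F ∈ m ^ (n + 1) →
      ∀ s, coeff s F ∈ m)
    (v : Fin r → R)
    (hv : ∀ c : (Fin r → Fin p) → R, ∑ β, c β ^ p * ∏ i, v i ^ (β i : ℕ) ∈ m → ∀ β, c β ∈ m) :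
    ∀ (n : ℕ) (c : (Fin d → Fin p) → (Fin r → Fin p) → R),
      ∑ α, ∑ β, c α β ^ p * ((∏ i, x i ^ (α i : ℕ)) * ∏ i, v i ^ (β i : ℕ)) ∈ m ^ n →
      ∀ α β s, p * s + ∑ i, (α i : ℕ) < n → c α β ∈ m ^ (s + 1) := by
  classical
  have hp0 : 0 < p := hp.out.pos
  have hxi : ∀ i, x i ∈ m := fun i => hxm ▸ Ideal.subset_span (Set.mem_range_self i)
  intro n
  induction n with
  | zero => intro c _ α β s h; omega
  | succ n ih =>
    intro c hc
    have ihc := ih c (Ideal.pow_le_pow_right (Nat.le_succ n) hc)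
    -- choose homogeneous representatives
    have hex : ∀ α β, ∃ P : MvPolynomial (Fin d) R,
        (∀ s, p * s + ∑ i, (α i : ℕ) = n → P.IsHomogeneous s ∧ eval x P = c α β) ∧
        ((¬ ∃ s, p * s + ∑ i, (α i : ℕ) = n) → P = 0) := by
      intro α β
      by_cases h : ∃ s, p * s + ∑ i, (α i : ℕ) = n
      · obtain ⟨s, hs⟩ := h
        have hcs : c α β ∈ m ^ s := by
          cases s with
          | zero => simp
          | succ s => exact ihc α β s (by rw [← hs, Nat.mul_succ]; omega)
        rw [← hxm] at hcs
        obtain ⟨P, hP, hPe⟩ := (Ideal.mem_span_pow_iff_exists_isHomogeneous x _).1 hcs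
        refine ⟨P, fun s' hs' => ?_, fun h => absurd ⟨s, hs⟩ h⟩
        have : s' = s := Nat.eq_of_mul_eq_mul_left hp0 (by omega)
        rw [this]; exact ⟨hP, hPe⟩
      · exact ⟨0, fun s hs => absurd ⟨s, hs⟩ h, fun _ => rfl⟩
    choose P hP1 hP0 using hex
    let af : (Fin d → Fin p) → (Fin d →₀ ℕ) := fun α =>
      Finsupp.equivFunOnFinite.symm (fun i => (α i : ℕ))
    have hafi : ∀ α i, af α i = (α i : ℕ) := fun α i => rfl
    have hafd : ∀ α, (af α).degree = ∑ i, (α i : ℕ) := fun α => by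
      rw [Finsupp.degree_eq_sum]; rfl
    let F : MvPolynomial (Fin d) R :=
      ∑ α, ∑ β, monomial (af α) (∏ i, v i ^ (β i : ℕ)) * P α β ^ p
    have hFh : F.IsHomogeneous n := by
      refine IsHomogeneous.sum _ _ _ fun α _ => IsHomogeneous.sum _ _ _ fun β _ => ?_
      by_cases h : ∃ s, p * s + ∑ i, (α i : ℕ) = n
      · obtain ⟨s, hs⟩ := h
        have h1 := (isHomogeneous_monomial (∏ i, v i ^ (β i : ℕ)) (hafd α)).mul
          ((hP1 α β s hs).1.pow p)
        have e : (∑ i, (α i : ℕ)) + s * p = n := by rw [← hs]; ring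
        rwa [e] at h1
      · rw [hP0 α β h, zero_pow hp.out.ne_zero, mul_zero]
        exact isHomogeneous_zero _ _ _
    have hev : eval x F ∈ m ^ (n + 1) := by
      have hd : eval x F - ∑ α, ∑ β, c α β ^ p *
          ((∏ i, x i ^ (α i : ℕ)) * ∏ i, v i ^ (β i : ℕ)) ∈ m ^ (n + 1) := by
        simp only [F, map_sum]
        rw [← Finset.sum_sub_distrib]
        refine Ideal.sum_mem _ fun α _ => ?_
        rw [← Finset.sum_sub_distrib]
        refine Ideal.sum_mem _ fun β _ => ?_
        have hmon : eval x (monomial (af α) (∏ i, v i ^ (β i : ℕ))) =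
            (∏ i, v i ^ (β i : ℕ)) * ∏ i, x i ^ (α i : ℕ) := by
          rw [eval_monomial, Finsupp.prod_fintype _ _ (by simp)]
          rfl
        by_cases h : ∃ s, p * s + ∑ i, (α i : ℕ) = n
        · obtain ⟨s, hs⟩ := h
          rw [map_mul, map_pow, (hP1 α β s hs).2, hmon]
          convert Ideal.zero_mem _ using 1
          ring
        · rw [hP0 α β h, zero_pow hp.out.ne_zero, mul_zero, map_zero, zero_sub]
          refine neg_mem ?_
          rw [← mul_assoc]
          refine Ideal.mul_mem_right _ _ ?_
          have hxa := kp_prod_mem x m hxi (fun i => (α i : ℕ))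
          rcases Nat.lt_or_ge n (∑ i, (α i : ℕ)) with hl | hl
          · exact Ideal.mul_mem_left _ _ (Ideal.pow_le_pow_right hl hxa)
          · -- `s` is the largest with `p * s + |α| ≤ n`
            have hs1 : p * ((n - ∑ i, (α i : ℕ)) / p) ≤ n - ∑ i, (α i : ℕ) := Nat.mul_div_le _ _
            have hs2 := Nat.lt_mul_div_succ (n - ∑ i, (α i : ℕ)) hp0
            set s := (n - ∑ i, (α i : ℕ)) / p
            have hne : p * s + ∑ i, (α i : ℕ) ≠ n := fun h' => h ⟨s, h'⟩
            have h3 := ihc α β s (by omega)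
            have h4 := Ideal.mul_mem_mul (Ideal.pow_mem_pow h3 p) hxa
            rw [← pow_mul, ← pow_add] at h4
            refine Ideal.pow_le_pow_right ?_ h4
            rw [mul_comm]; omega
      simpa using Ideal.add_mem _ hd hc
    have hco := hqr n F hFh hev
    intro α β s hs
    rcases Nat.lt_or_ge (p * s + ∑ i, (α i : ℕ)) n with hlt | hge
    · exact ihc α β s hlt
    have hs : p * s + ∑ i, (α i : ℕ) = n := by omega
    rw [← (hP1 α β s hs).2, pow_succ', ← hxm]
    refine qr_eval_mem x _ _ (hP1 α β s hs).1 fun δ => ?_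
    rw [hxm]
    refine hv (fun β => coeff δ (P α β)) ?_ β
    have h1 := hco (p • δ + af α)
    have h2 : coeff (p • δ + af α) F = ∑ β, coeff δ (P α β) ^ p * ∏ i, v i ^ (β i : ℕ) := by
      simp only [F, coeff_sum]
      rw [Finset.sum_eq_single α]
      · exact Finset.sum_congr rfl fun β _ => by rw [kp_coeff_same, mul_comm]
      · intro α' _ hne
        refine Finset.sum_eq_zero fun β _ => kp_coeff_ne p _ _ _ _ _ (fun i => (α i).2)
          (fun i => (α' i).2) ?_
        intro h
        apply hne
        funext i
        exact Fin.ext (DFunLike.congr_fun h i)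
      · simp
    rw [← h2]; exact h1

open MvPolynomial in
theorem gen_p {R : Type*} [CommRing R] [IsLocalRing R] (p : ℕ) [hp : Fact p.Prime] [CharP R p]
    (hF : Module.Finite (↥(frobenius R p).range) R) {d r : ℕ}
    (x : Fin d → R) (hxm : Ideal.span (Set.range x) = IsLocalRing.maximalIdeal R)
    (v : Fin r → R)
    (hv : ∀ y, ∃ c : (Fin r → Fin p) → R,
        y - ∑ β, c β ^ p * ∏ i, v i ^ (β i : ℕ) ∈ IsLocalRing.maximalIdeal R) (y : R) :
    ∃ c : (Fin d → Fin p) → (Fin r → Fin p) → R,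
      y = ∑ α, ∑ β, c α β ^ p * ((∏ i, x i ^ (α i : ℕ)) * ∏ i, v i ^ (β i : ℕ)) := by
  classical
  set m := IsLocalRing.maximalIdeal R with hm
  have hxi : ∀ i, x i ∈ m := fun i => hxm ▸ Ideal.subset_span (Set.mem_range_self i)
  have hA : IsLocalRing (frobenius R p).range :=
    IsLocalRing.of_surjective' (frobenius R p).rangeRestrict (frobenius R p).rangeRestrict_surjective
  let z : (Fin d → Fin p) × (Fin r → Fin p) → R :=
    fun γ => (∏ i, x i ^ (γ.1 i : ℕ)) * ∏ i, v i ^ (γ.2 i : ℕ)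
  let N : Submodule (frobenius R p).range R := Submodule.span _ (Set.range z)
  let mA := IsLocalRing.maximalIdeal (frobenius R p).range
  let J : Submodule (frobenius R p).range R := mA • ⊤
  have hroot : ∀ i, (⟨frobenius R p (x i), x i, rfl⟩ : (frobenius R p).range) ∈ mA := by
    intro i
    rw [IsLocalRing.mem_maximalIdeal, mem_nonunits_iff]
    intro hu
    have h1 := hu.map (frobenius R p).range.subtype
    have h2 : IsUnit (x i ^ p) := h1
    exact (IsLocalRing.mem_maximalIdeal _).1 (hxi i) ((isUnit_pow_iff hp.out.ne_zero).1 h2)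
  have hJ1 : ∀ i b, x i ^ p * b ∈ J := fun i b =>
    Submodule.smul_mem_smul (hroot i) (Submodule.mem_top (x := b))
  have hJ2 : ∀ (s : Fin d → ℕ) (i : Fin d) (b : R), p ≤ s i → b * ∏ i, x i ^ s i ∈ J := by
    intro s i b hs
    rw [← Finset.mul_prod_erase _ _ (Finset.mem_univ i)]
    have : x i ^ s i = x i ^ p * x i ^ (s i - p) := by rw [← pow_add]; congr 1; omega
    rw [this]
    convert hJ1 i (b * (x i ^ (s i - p) * ∏ j ∈ Finset.univ.erase i, x j ^ s j)) using 1
    ring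
  have hS1 : ∀ (s : Fin d → ℕ) (β : Fin r → Fin p) (t : R),
      t ^ p * (∏ i, v i ^ (β i : ℕ)) * (∏ i, x i ^ s i) ∈ N ⊔ J := by
    intro s β t
    by_cases h : ∃ i, p ≤ s i
    · obtain ⟨i, hi⟩ := h
      exact Submodule.mem_sup_right (hJ2 s i _ hi)
    · push Not at h
      refine Submodule.mem_sup_left ?_
      have h1 : z (fun i => ⟨s i, h i⟩, β) ∈ N := Submodule.subset_span ⟨_, rfl⟩
      have h2 := N.smul_mem (⟨frobenius R p t, t, rfl⟩ : (frobenius R p).range) h1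
      rw [Subring.smul_def] at h2
      convert h2 using 1
      simp only [z, frobenius_def, smul_eq_mul]
      ring
  have hterm : ∀ (k : ℕ) (T : Submodule (frobenius R p).range R),
      (∀ (b : R) (s : Fin d →₀ ℕ), ∑ i, s i = k → b * ∏ i, x i ^ s i ∈ T) →
      ∀ y ∈ m ^ k, y ∈ T := by
    intro k T hT y hy
    rw [← hxm] at hy
    obtain ⟨F, hFh, rfl⟩ := (Ideal.mem_span_pow_iff_exists_isHomogeneous x y).1 hy
    rw [eval_eq']
    refine Submodule.sum_mem _ fun s hs => hT _ _ ?_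
    have := hFh (mem_support_iff.1 hs)
    rw [qr_weight_one, Finsupp.degree_eq_sum] at this
    exact this
  have hbase : ∀ y ∈ m ^ (d * p + 1), y ∈ N ⊔ J := by
    apply hterm
    intro b s hs
    by_contra hcon
    have : ∀ i, s i ≤ p := by
      intro i
      by_contra hi
      exact hcon (Submodule.mem_sup_right (hJ2 s i b (by omega)))
    have := Finset.sum_le_card_nsmul Finset.univ s p (fun i _ => this i)
    rw [hs] at this
    simp at this
  have hdown : ∀ j k, k + j = d * p + 1 → ∀ y ∈ m ^ k, y ∈ N ⊔ J := by
    intro j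
    induction j with
    | zero => intro k hk; rw [add_zero] at hk; rw [hk]; exact hbase
    | succ j ihj =>
      intro k hk
      apply hterm
      intro b s hs
      obtain ⟨c, hc⟩ := hv b
      have h1 : b * ∏ i, x i ^ s i = ∑ β, c β ^ p * (∏ i, v i ^ (β i : ℕ)) * (∏ i, x i ^ s i)
          + (b - ∑ β, c β ^ p * ∏ i, v i ^ (β i : ℕ)) * ∏ i, x i ^ s i := by
        rw [← Finset.sum_mul]; ring
      rw [h1]
      refine Submodule.add_mem _ (Submodule.sum_mem _ fun β _ => hS1 _ _ _) ?_
      refine ihj (k+1) (by omega) _ ?_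
      rw [pow_succ']
      refine Ideal.mul_mem_mul hc ?_
      rw [← hs]
      exact kp_prod_mem x m hxi s
  have htop : (⊤ : Submodule (frobenius R p).range R) ≤ N := by
    apply Submodule.le_of_le_smul_of_le_jacobson_bot (I := mA) hF.fg_top
    · exact IsLocalRing.maximalIdeal_le_jacobson _
    · intro y _
      exact hdown (d * p + 1) 0 (by simp) y (by simp)
  have hy : y ∈ N := htop trivial
  obtain ⟨c, hc⟩ := (Submodule.mem_span_range_iff_exists_fun _).1 hy
  choose c' hc' using fun γ => (c γ).2
  refine ⟨fun α β => c' (α, β), ?_⟩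
  rw [← hc, Fintype.sum_prod_type]
  refine Finset.sum_congr rfl fun α _ => Finset.sum_congr rfl fun β _ => ?_
  rw [Subring.smul_def, ← hc', frobenius_def, smul_eq_mul]

/-- Every element is a combination of monomials in `z` with exponents `< q` with coefficients
`q`-th powers. -/
def QSpan {R ι : Type*} [CommRing R] [Fintype ι] [DecidableEq ι] (z : ι → R) (q : ℕ) : Prop :=
  ∀ y, ∃ c : (ι → Fin q) → R, y = ∑ γ, c γ ^ q * ∏ i, z i ^ (γ i : ℕ)

/-- Strong independence of the monomials with respect to the `m`-adic filtration. -/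
def QInd {R ι : Type*} [CommRing R] [Fintype ι] [DecidableEq ι] (m : Ideal R) (w : ι → ℕ)
    (z : ι → R) (q : ℕ) : Prop :=
  ∀ (n : ℕ) (c : (ι → Fin q) → R), ∑ γ, c γ ^ q * ∏ i, z i ^ (γ i : ℕ) ∈ m ^ n →
    ∀ γ s, q * s + ∑ i, w i * (γ i : ℕ) < n → c γ ∈ m ^ (s + 1)

/-- Exponent digits. -/
def digitEquiv (ι : Type*) (p q : ℕ) : (ι → Fin q) × (ι → Fin p) ≃ (ι → Fin (q * p)) :=
  (Equiv.arrowProdEquivProdArrow ι (fun _ => Fin q) (fun _ => Fin p)).symm.trans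
    (Equiv.piCongrRight fun _ => finProdFinEquiv)

theorem digitEquiv_apply {ι : Type*} {p q : ℕ} (a : ι → Fin q) (b : ι → Fin p) (i : ι) :
    ((digitEquiv ι p q (a, b)) i : ℕ) = b i + p * a i := rfl

theorem digit_sum {R ι : Type*} [CommRing R] [Fintype ι] [DecidableEq ι]
    (p : ℕ) [hp : Fact p.Prime] [CharP R p] (q : ℕ) (z : ι → R) (c : (ι → Fin (q * p)) → R) :
    ∑ γ, c γ ^ (q * p) * ∏ i, z i ^ (γ i : ℕ) =
    ∑ b : ι → Fin p, (∑ a : ι → Fin q, c (digitEquiv ι p q (a, b)) ^ q * ∏ i, z i ^ (a i : ℕ)) ^ p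
      * ∏ i, z i ^ (b i : ℕ) := by
  rw [← (digitEquiv ι p q).sum_comp, Fintype.sum_prod_type_right]
  refine Finset.sum_congr rfl fun b _ => ?_
  rw [sum_pow_char p, Finset.sum_mul]
  refine Finset.sum_congr rfl fun a _ => ?_
  rw [mul_pow, ← pow_mul, mul_assoc, ← Finset.prod_pow, ← Finset.prod_mul_distrib]
  congr 1
  refine Finset.prod_congr rfl fun i _ => ?_
  rw [digitEquiv_apply, ← pow_mul, ← pow_add]
  congr 1; ring

theorem QSpan.pow {R ι : Type*} [CommRing R] [Fintype ι] [DecidableEq ι]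
    (p : ℕ) [hp : Fact p.Prime] [CharP R p] (z : ι → R) (h : QSpan z p) (e : ℕ) :
    QSpan z (p ^ e) := by
  induction e with
  | zero =>
    rw [pow_zero]
    intro y
    refine ⟨fun _ => y, ?_⟩
    rw [Fintype.sum_unique]
    simp
  | succ e ih =>
    intro y
    rw [pow_succ]
    obtain ⟨c, hc⟩ := h y
    choose c' hc' using fun b => ih (c b)
    refine ⟨fun γ => c' ((digitEquiv ι p _).symm γ).2 ((digitEquiv ι p _).symm γ).1, ?_⟩
    rw [digit_sum, hc]
    refine Finset.sum_congr rfl fun b _ => ?_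
    conv_lhs => rw [hc' b]
    simp

theorem QInd.pow {R ι : Type*} [CommRing R] [Fintype ι] [DecidableEq ι] (m : Ideal R) (w : ι → ℕ)
    (p : ℕ) [hp : Fact p.Prime] [CharP R p] (z : ι → R) (h : QInd m w z p) (e : ℕ) :
    QInd m w z (p ^ e) := by
  induction e with
  | zero =>
    rw [pow_zero]
    intro n c hc γ s hs
    rw [Fintype.sum_unique] at hc
    have hγ : γ = default := Subsingleton.elim _ _
    subst hγ
    simp at hc hs
    exact Ideal.pow_le_pow_right (by omega) hc
  | succ e ih =>
    rw [pow_succ]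
    intro n c hc γ s hs
    rw [digit_sum] at hc
    obtain ⟨⟨a, b⟩, rfl⟩ := (digitEquiv ι p (p ^ e)).surjective γ
    simp only [digitEquiv_apply] at hs
    have hs' : p * (p ^ e * s + ∑ i, w i * (a i : ℕ)) + ∑ i, w i * (b i : ℕ) < n := by
      convert hs using 1
      simp only [mul_add, Finset.sum_add_distrib, Finset.mul_sum]
      have : ∀ i, w i * (p * (a i : ℕ)) = p * (w i * (a i : ℕ)) := fun i => by ring
      simp only [this]
      ring
    have h1 := h n _ hc b _ hs'
    exact ih _ _ h1 a s (Nat.lt_succ_self _)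

theorem qspan_sum {R : Type*} [CommRing R] {d r : ℕ} (q : ℕ) (x : Fin d → R) (v : Fin r → R)
    (c : (Fin d ⊕ Fin r → Fin q) → R) :
    ∑ γ, c γ ^ q * ∏ i, Sum.elim x v i ^ (γ i : ℕ) =
    ∑ α : Fin d → Fin q, ∑ β : Fin r → Fin q, c (Sum.elim α β) ^ q *
      ((∏ i, x i ^ (α i : ℕ)) * ∏ i, v i ^ (β i : ℕ)) := by
  rw [← (Equiv.sumArrowEquivProdArrow (Fin d) (Fin r) (Fin q)).symm.sum_comp,
    Fintype.sum_prod_type]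
  refine Finset.sum_congr rfl fun α _ => Finset.sum_congr rfl fun β _ => ?_
  rw [Fintype.prod_sum_type]
  rfl

theorem qspan_of {R : Type*} [CommRing R] {d r : ℕ} (q : ℕ) (x : Fin d → R) (v : Fin r → R)
    (h : ∀ y, ∃ c : (Fin d → Fin q) → (Fin r → Fin q) → R,
      y = ∑ α, ∑ β, c α β ^ q * ((∏ i, x i ^ (α i : ℕ)) * ∏ i, v i ^ (β i : ℕ))) :
    QSpan (Sum.elim x v) q := by
  intro y
  obtain ⟨c, hc⟩ := h y
  refine ⟨fun γ => c (fun i => γ (Sum.inl i)) (fun i => γ (Sum.inr i)), ?_⟩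
  rw [qspan_sum, hc]
  rfl

theorem qind_of {R : Type*} [CommRing R] {d r : ℕ} (m : Ideal R) (q : ℕ) (x : Fin d → R)
    (v : Fin r → R)
    (h : ∀ (n : ℕ) (c : (Fin d → Fin q) → (Fin r → Fin q) → R),
      ∑ α, ∑ β, c α β ^ q * ((∏ i, x i ^ (α i : ℕ)) * ∏ i, v i ^ (β i : ℕ)) ∈ m ^ n →
      ∀ α β s, q * s + ∑ i, (α i : ℕ) < n → c α β ∈ m ^ (s + 1)) :
    QInd m (Sum.elim (fun _ => 1) (fun _ => 0)) (Sum.elim x v) q := by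
  intro n c hc γ s hs
  rw [qspan_sum] at hc
  have := h n (fun α β => c (Sum.elim α β)) hc (fun i => γ (Sum.inl i)) (fun i => γ (Sum.inr i)) s
    (by simpa using hs)
  have e : Sum.elim (fun i => γ (Sum.inl i)) (fun i => γ (Sum.inr i)) = γ := by
    funext i; cases i <;> rfl
  rwa [e] at this


theorem IsDiffOp.zero' {R : Type*} [CommRing R] (n : ℕ) : IsDiffOp R n 0 := by
  induction n with
  | zero => intro r s; simp
  | succ n ih => intro r; simpa using ih

theorem IsDiffOp.add' {R : Type*} [CommRing R] {n : ℕ} {D E : R →+ R} (hD : IsDiffOp R n D)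
    (hE : IsDiffOp R n E) : IsDiffOp R n (D + E) := by
  induction n generalizing D E with
  | zero => intro r s; simp [hD r s, hE r s, mul_add]
  | succ n ih =>
    intro r
    convert ih (hD r) (hE r) using 1
    ext s; simp; ring

theorem IsDiffOp.lmul {R : Type*} [CommRing R] {n : ℕ} {D : R →+ R} (hD : IsDiffOp R n D)
    (t : R) : IsDiffOp R n ((AddMonoidHom.mulLeft t).comp D) := by
  induction n generalizing D with
  | zero => intro r s; simp [hD r s]; ring
  | succ n ih =>
    intro r
    convert ih (hD r) using 1
    ext s; simp; ring

theorem IsDiffOp.succ' {R : Type*} [CommRing R] {n : ℕ} {D : R →+ R} (hD : IsDiffOp R n D) :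
    IsDiffOp R (n + 1) D := by
  induction n generalizing D with
  | zero =>
    intro r
    convert IsDiffOp.zero' (R := R) 0 using 1
    ext s; simp [hD r s]
  | succ n ih => intro r; exact ih (hD r)

theorem IsDiffOp.mono' {R : Type*} [CommRing R] {n k : ℕ} {D : R →+ R} (hD : IsDiffOp R n D)
    (h : n ≤ k) : IsDiffOp R k D := by
  induction h with
  | refl => exact hD
  | step _ ih => exact ih.succ'

theorem IsDiffOp.sum' {R : Type*} [CommRing R] {n : ℕ} {κ : Type*} (S : Finset κ)
    (D : κ → (R →+ R)) (hD : ∀ k ∈ S, IsDiffOp R n (D k)) : IsDiffOp R n (∑ k ∈ S, D k) := by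
  classical
  induction S using Finset.induction_on with
  | empty => simpa using IsDiffOp.zero' n
  | insert a S ha ih =>
    rw [Finset.sum_insert ha]
    exact (hD a (by simp)).add' (ih fun k hk => hD k (by simp [hk]))

theorem IsDiffOp.mem_pow {R : Type*} [CommRing R] (m : Ideal R) {i : ℕ} {D : R →+ R}
    (hD : IsDiffOp R i D) : ∀ (N : ℕ) (y : R), y ∈ m ^ N → D y ∈ m ^ (N - i) := by
  induction i generalizing D with
  | zero =>
    intro N y hy
    have := hD y 1
    rw [mul_one] at this
    rw [this]
    exact Ideal.mul_mem_right _ _ hy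
  | succ i ih =>
    intro N
    induction N with
    | zero => intro y _; simp
    | succ N ihN =>
      intro y hy
      rw [pow_succ'] at hy
      induction hy using Submodule.mul_induction_on' with
      | mem_mul_mem r hr s hs =>
        have h1 := ih (hD r) N s hs
        have h2 := ihN s hs
        have h3 : D (r * s) = r * D s +
          ((D.comp (AddMonoidHom.mulLeft r)) - ((AddMonoidHom.mulLeft r).comp D)) s := by simp
        rw [h3]
        refine Ideal.add_mem _ ?_ ?_
        · have := Ideal.mul_mem_mul hr h2
          rw [← pow_succ'] at this
          exact Ideal.pow_le_pow_right (by omega) this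
        · convert h1 using 2; omega
      | add a _ b _ ha hb => rw [map_add]; exact Ideal.add_mem _ ha hb

/-- Precomposition with multiplication by `t`. -/
def rightMul {R : Type*} [CommRing R] (t : R) : AddMonoid.End (R →+ R) where
  toFun D := D.comp (AddMonoidHom.mulLeft t)
  map_zero' := by ext; simp
  map_add' D E := by ext; simp

/-- Postcomposition with multiplication by `t`. -/
def leftMul {R : Type*} [CommRing R] (t : R) : AddMonoid.End (R →+ R) where
  toFun D := (AddMonoidHom.mulLeft t).comp D
  map_zero' := by ext; simp
  map_add' D E := by ext; simp [mul_add]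

theorem endMul_apply {M : Type*} [AddCommMonoid M] (f g : AddMonoid.End M) (a : M) :
    (f * g) a = f (g a) := rfl

theorem rightMul_pow {R : Type*} [CommRing R] (t : R) (n : ℕ) (D : R →+ R) (s : R) :
    (rightMul t ^ n) D s = D (t ^ n * s) := by
  induction n generalizing D s with
  | zero => simp
  | succ n ih =>
    rw [pow_succ, endMul_apply, ih, pow_succ']
    rw [mul_assoc]; rfl

theorem leftMul_pow {R : Type*} [CommRing R] (t : R) (n : ℕ) (D : R →+ R) (s : R) :
    (leftMul t ^ n) D s = t ^ n * D s := by
  induction n generalizing D s with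
  | zero => simp
  | succ n ih =>
    rw [pow_succ, endMul_apply, ih]
    rw [pow_succ, mul_assoc]; rfl

theorem IsDiffOp.ad_pow {R : Type*} [CommRing R] (t : R) {n : ℕ} {D : R →+ R}
    (hD : IsDiffOp R n D) : ((rightMul t - leftMul t) ^ (n + 1)) D = 0 := by
  induction n generalizing D with
  | zero =>
    ext s
    rw [zero_add, pow_one]
    change D (t * s) - t * D s = 0
    rw [hD, sub_self]
  | succ n ih =>
    rw [pow_succ, endMul_apply]
    exact ih (hD t)

theorem IsDiffOp.pow_linear {R : Type*} [CommRing R] (p : ℕ) [hp : Fact p.Prime] [CharP R p]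
    (e : ℕ) {n : ℕ} (hn : n < p ^ e) {D : R →+ R} (hD : IsDiffOp R n D) (t s : R) :
    D (t ^ p ^ e * s) = t ^ p ^ e * D s := by
  have hcomm : Commute (leftMul t) (rightMul t - leftMul t) := by
    apply Commute.sub_right
    · ext D s; rfl
    · exact Commute.refl _
  have h := hcomm.add_pow (p ^ e)
  rw [add_sub_cancel] at h
  have h1 := congrArg (fun T : AddMonoid.End (R →+ R) => T D s) h
  simp only [rightMul_pow] at h1
  rw [h1]
  have hsum : ∀ (S : Finset ℕ) (f : ℕ → AddMonoid.End (R →+ R)),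
      (∑ k ∈ S, f k) D s = ∑ k ∈ S, f k D s := by
    intro S f
    classical
    induction S using Finset.induction_on with
    | empty => simp
    | insert a S ha ih => rw [Finset.sum_insert ha, Finset.sum_insert ha, ← ih]; rfl
  rw [hsum, Finset.sum_eq_single (p ^ e)]
  · rw [Nat.sub_self, pow_zero, mul_one, Nat.choose_self, Nat.cast_one, mul_one, leftMul_pow]
  · intro k hk hk'
    rw [(Nat.cast_commute _ _).symm.eq, endMul_apply]
    have hnat : ∀ (c : ℕ) (T : R →+ R), ((c : AddMonoid.End (R →+ R)) T) s = (c : R) * T s := by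
      intro c T
      simp
    rw [hnat]
    by_cases hk0 : k = 0
    · subst hk0
      rw [pow_zero, one_mul, Nat.sub_zero]
      have hz : ((rightMul t - leftMul t) ^ (p ^ e)) D = 0 := by
        have := (hD.mono' (k := p ^ e - 1) (by omega)).ad_pow t
        rwa [Nat.sub_add_cancel (by omega)] at this
      rw [hz]; simp
    · have : ((((p ^ e).choose k : ℕ)) : R) = 0 :=
        (CharP.cast_eq_zero_iff R p _).2 (hp.out.dvd_choose_pow hk0 hk')
      rw [this, zero_mul]
  · simp

theorem choose_add_q {R : Type*} [CommRing R] (p : ℕ) [hp : Fact p.Prime] [CharP R p]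
    (e n a : ℕ) (hn : n < p ^ e) (k : ℕ) :
    ((a + p ^ e * k).choose n : R) = (a.choose n : R) := by
  induction k with
  | zero => simp
  | succ k ih =>
    rw [← ih, Nat.mul_succ, ← add_assoc, Nat.add_choose_eq, Nat.cast_sum]
    rw [Finset.sum_eq_single (n, 0)]
    · simp
    · rintro ⟨i, j⟩ hij hne
      rw [Finset.HasAntidiagonal.mem_antidiagonal] at hij
      have hj0 : j ≠ 0 := by
        rintro rfl
        apply hne
        simp at hij
        simp [hij]
      have hjq : j ≠ p ^ e := by simp at hij; omega
      rw [Nat.cast_mul, (CharP.cast_eq_zero_iff R p _).2 (hp.out.dvd_choose_pow hj0 hjq), mul_zero]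
    · intro h; simp at h

theorem exists_choose_ne (p : ℕ) [hp : Fact p.Prime] (n : ℕ) (hn : n ≠ 0) :
    ∃ l, p ^ l ≤ n ∧ ¬ p ∣ n.choose (p ^ l) := by
  have key : ∀ l k, (p ^ l * k).choose (p ^ l) ≡ k [MOD p] := by
    intro l k
    induction l with
    | zero => simp [Nat.ModEq.refl]
    | succ l ih =>
      refine Nat.ModEq.trans Choose.choose_modEq_choose_mod_mul_choose_div_nat ?_
      have h1 : p ^ (l + 1) * k % p = 0 := by
        rw [pow_succ, mul_assoc, mul_left_comm]; exact Nat.mul_mod_right _ _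
      have h2 : p ^ (l + 1) % p = 0 := by rw [pow_succ]; exact Nat.mul_mod_left _ _
      have h3 : p ^ (l + 1) * k / p = p ^ l * k := by
        rw [pow_succ, mul_right_comm]; exact Nat.mul_div_cancel _ hp.out.pos
      have h4 : p ^ (l + 1) / p = p ^ l := by
        rw [pow_succ]; exact Nat.mul_div_cancel _ hp.out.pos
      rw [h1, h2, h3, h4]
      simpa using ih
  obtain ⟨l, k, hk, rfl⟩ := Nat.exists_eq_pow_mul_and_not_dvd hn p hp.out.ne_one
  refine ⟨l, Nat.le_mul_of_pos_right _ (Nat.pos_of_ne_zero ?_), ?_⟩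
  · rintro rfl; simp at hk
  · rwa [(key l k).dvd_iff dvd_rfl]

/-- Monomials in `z`. -/
def mon {R ι : Type*} [CommRing R] [Fintype ι] (z : ι → R) (γ : ι → ℕ) : R := ∏ i, z i ^ γ i

theorem mon_add {R ι : Type*} [CommRing R] [Fintype ι] (z : ι → R) (γ δ : ι → ℕ) :
    mon z (γ + δ) = mon z γ * mon z δ := by
  simp [mon, pow_add, Finset.prod_mul_distrib]

theorem mon_pow {R ι : Type*} [CommRing R] [Fintype ι] (z : ι → R) (γ : ι → ℕ) (q : ℕ) :
    mon z γ ^ q = mon z (fun i => q * γ i) := by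
  simp only [mon]
  rw [← Finset.prod_pow]
  exact Finset.prod_congr rfl fun i _ => by rw [← pow_mul, mul_comm]

theorem hasse_def {R ι : Type*} [CommRing R] [Fintype ι] [DecidableEq ι]
    (p : ℕ) [hp : Fact p.Prime] [CharP R p] (e : ℕ) (z : ι → R)
    (hS : ∀ y, ∃ c : (ι → Fin (p ^ e)) → R, y = ∑ γ, c γ ^ (p ^ e) * mon z (fun i => (γ i : ℕ)))
    (hU : ∀ c c' : (ι → Fin (p ^ e)) → R,
      ∑ γ, c γ ^ (p ^ e) * mon z (fun i => (γ i : ℕ)) =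
      ∑ γ, c' γ ^ (p ^ e) * mon z (fun i => (γ i : ℕ)) → c = c') (i : ι) :
    ∃ D : ℕ → (R →+ R), ∀ n < p ^ e, ∀ (t : R) (γ : ι → ℕ), D n (t ^ (p ^ e) * mon z γ) =
      t ^ (p ^ e) * (((γ i).choose n : R) * mon z (γ - Pi.single i n)) := by
  choose cf hcf using hS
  have hq0 : 0 < p ^ e := pow_pos hp.out.pos e
  have hadd : ∀ a b, cf (a + b) = cf a + cf b := by
    intro a b
    apply hU
    rw [← hcf]
    simp only [Pi.add_apply, add_pow_char_pow, add_mul, Finset.sum_add_distrib]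
    rw [← hcf, ← hcf]
  have hzero : cf 0 = 0 := by simpa using hadd 0 0
  refine ⟨fun n =>
    { toFun := fun y => ∑ γ, cf y γ ^ (p ^ e) *
        ((((γ i : ℕ)).choose n : R) * mon z ((fun i => (γ i : ℕ)) - Pi.single i n))
      map_zero' := by simp [hzero, hp.out.ne_zero]
      map_add' := fun a b => by
        simp only [hadd, Pi.add_apply, add_pow_char_pow, add_mul, Finset.sum_add_distrib] },
    fun n hn t γ => ?_⟩
  let γ0 : ι → Fin (p ^ e) := fun j => ⟨γ j % p ^ e, Nat.mod_lt _ hq0⟩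
  have hdec : γ = (fun j => p ^ e * (γ j / p ^ e)) + (fun j => γ j % p ^ e) := by
    funext j; exact (Nat.div_add_mod (γ j) (p ^ e)).symm
  have hc : cf (t ^ (p ^ e) * mon z γ) = Pi.single γ0 (t * mon z (fun j => γ j / p ^ e)) := by
    apply hU
    rw [← hcf, Finset.sum_eq_single γ0]
    · rw [Pi.single_eq_same, mul_pow, mon_pow, mul_assoc, ← mon_add]
      conv_lhs => rw [hdec]
    · intro b _ hb
      rw [Pi.single_eq_of_ne hb, zero_pow hq0.ne', zero_mul]
    · simp
  simp only [AddMonoidHom.coe_mk, ZeroHom.coe_mk]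
  rw [hc, Finset.sum_eq_single γ0]
  · rw [Pi.single_eq_same, mul_pow, mon_pow, mul_assoc]
    congr 1
    have hch : ((γ i).choose n : R) = ((γ i % p ^ e).choose n : R) := by
      conv_lhs => rw [← Nat.mod_add_div (γ i) (p ^ e)]
      exact choose_add_q p e n _ hn _
    rw [hch]
    change _ * (((γ i % p ^ e).choose n : R) * _) = _
    by_cases hle : n ≤ γ i % p ^ e
    · rw [mul_left_comm, ← mon_add]
      congr 2
      funext j
      have hj := Nat.div_add_mod (γ j) (p ^ e)
      by_cases hji : j = i
      · subst hji
        simp only [Pi.add_apply, Pi.sub_apply, Pi.single_eq_same, γ0]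
        omega
      · simp only [Pi.add_apply, Pi.sub_apply, Pi.single_eq_of_ne hji, γ0]
        omega
    · rw [Nat.choose_eq_zero_of_lt (by omega)]; simp
  · intro b _ hb
    rw [Pi.single_eq_of_ne hb, zero_pow hq0.ne', zero_mul]
  · simp

theorem hasse_leibniz {R ι : Type*} [CommRing R] [Fintype ι] [DecidableEq ι]
    (q : ℕ) (z : ι → R)
    (hS : ∀ y, ∃ c : (ι → Fin q) → R, y = ∑ γ, c γ ^ q * mon z (fun i => (γ i : ℕ)))
    (i : ι) (D : ℕ → (R →+ R)) (hD : ∀ n < q, ∀ (t : R) (γ : ι → ℕ), D n (t ^ q * mon z γ) =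
      t ^ q * (((γ i).choose n : R) * mon z (γ - Pi.single i n))) (n : ℕ) (hn : n < q) (r s : R) :
    D n (r * s) = ∑ ab ∈ Finset.HasAntidiagonal.antidiagonal n, D ab.1 r * D ab.2 s := by
  have key : ∀ (t t' : R) (γ γ' : ι → ℕ), D n ((t ^ q * mon z γ) * (t' ^ q * mon z γ')) =
      ∑ ab ∈ Finset.HasAntidiagonal.antidiagonal n, D ab.1 (t ^ q * mon z γ) * D ab.2 (t' ^ q * mon z γ') := by
    intro t t' γ γ'
    have e1 : (t ^ q * mon z γ) * (t' ^ q * mon z γ') = (t * t') ^ q * mon z (γ + γ') := by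
      rw [mon_add]; ring
    rw [e1, hD n hn, Pi.add_apply, Nat.add_choose_eq, Nat.cast_sum, Finset.sum_mul, Finset.mul_sum]
    refine Finset.sum_congr rfl fun ab hab => ?_
    rw [Finset.HasAntidiagonal.mem_antidiagonal] at hab
    rw [hD _ (by omega), hD _ (by omega)]
    by_cases h1 : ab.1 ≤ γ i
    · by_cases h2 : ab.2 ≤ γ' i
      · have e2 : γ + γ' - Pi.single i n = (γ - Pi.single i ab.1) + (γ' - Pi.single i ab.2) := by
          funext j
          by_cases hji : j = i
          · subst hji
            simp only [Pi.add_apply, Pi.sub_apply, Pi.single_eq_same]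
            omega
          · simp only [Pi.add_apply, Pi.sub_apply, Pi.single_eq_of_ne hji]
            omega
        rw [e2, mon_add]
        push_cast
        ring
      · rw [Nat.choose_eq_zero_of_lt (n := γ' i) (by omega)]; simp
    · rw [Nat.choose_eq_zero_of_lt (n := γ i) (by omega)]; simp
  obtain ⟨c, hc⟩ := hS r
  obtain ⟨c', hc'⟩ := hS s
  rw [hc, hc', Finset.sum_mul_sum]
  simp only [map_sum, key]
  simp only [Finset.sum_mul_sum]
  symm
  rw [Finset.sum_comm]
  exact Finset.sum_congr rfl fun γ _ => Finset.sum_comm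

theorem hasse_order {R ι : Type*} [CommRing R] [Fintype ι] [DecidableEq ι]
    (q : ℕ) (z : ι → R)
    (hS : ∀ y, ∃ c : (ι → Fin q) → R, y = ∑ γ, c γ ^ q * mon z (fun i => (γ i : ℕ)))
    (i : ι) (D : ℕ → (R →+ R)) (hD : ∀ n < q, ∀ (t : R) (γ : ι → ℕ), D n (t ^ q * mon z γ) =
      t ^ q * (((γ i).choose n : R) * mon z (γ - Pi.single i n))) (n : ℕ) (hn : n < q) :
    IsDiffOp R n (D n) := by
  have h0 : ∀ r, D 0 r = r := by
    intro r
    obtain ⟨c, hc⟩ := hS r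
    rw [hc, map_sum]
    refine Finset.sum_congr rfl fun γ _ => ?_
    rw [hD 0 (by omega)]
    simp
  induction n using Nat.strong_induction_on with
  | _ n ih =>
    cases n with
    | zero => intro r s; rw [h0, h0]
    | succ n =>
      intro r
      have e1 : ((D (n+1)).comp (AddMonoidHom.mulLeft r)) - ((AddMonoidHom.mulLeft r).comp (D (n+1)))
          = ∑ ab ∈ Finset.HasAntidiagonal.antidiagonal n,
            (AddMonoidHom.mulLeft (D (ab.1 + 1) r)).comp (D ab.2) := by
        ext s
        simp only [AddMonoidHom.sub_apply, AddMonoidHom.comp_apply, AddMonoidHom.coe_mulLeft,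
          AddMonoidHom.finsetSum_apply]
        rw [hasse_leibniz q z hS i D hD _ hn, Finset.Nat.sum_antidiagonal_succ, h0]
        simp
      rw [e1]
      refine IsDiffOp.sum' _ _ fun ab hab => ?_
      rw [Finset.HasAntidiagonal.mem_antidiagonal] at hab
      exact ((ih ab.2 (by omega) (by omega)).lmul _).mono' (by omega)

theorem reg_data (R : Type*) [CommRing R] [IsLocalRing R] (hreg : IsRegularLocal R) :
    ∃ (d : ℕ) (x : Fin d → R), Ideal.span (Set.range x) = IsLocalRing.maximalIdeal R ∧
      ∀ i y, x i * y ∈ Ideal.span (x '' {j | i < j}) → y ∈ Ideal.span (x '' {j | i < j}) := by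
  obtain ⟨-, rs, hr, hm⟩ := hreg
  refine ⟨rs.length, fun i => rs.get i.rev, ?_, ?_⟩
  · rw [← hm]
    congr 1
    ext y
    constructor
    · rintro ⟨i, rfl⟩
      exact List.get_mem _ _
    · intro hy
      obtain ⟨i, hi⟩ := List.get_of_mem hy
      exact ⟨i.rev, by simpa using hi⟩
  · intro i y hy
    have hset : Ideal.span ((fun i : Fin rs.length => rs.get i.rev) '' {j | i < j}) =
        Ideal.ofList (rs.take (i.rev : ℕ)) := by
      rw [Ideal.ofList]
      congr 1
      ext y
      constructor
      · rintro ⟨j, hj, rfl⟩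
        have hlt : (j.rev : ℕ) < i.rev := Fin.rev_lt_rev.mpr hj
        show rs.get j.rev ∈ rs.take (i.rev : ℕ)
        rw [List.mem_take_iff_getElem]
        exact ⟨j.rev, lt_min hlt j.rev.2, rfl⟩
      · intro hy
        have hy' : y ∈ rs.take (i.rev : ℕ) := hy
        rw [List.mem_take_iff_getElem] at hy'
        obtain ⟨k, hk, rfl⟩ := hy'
        have hk1 : k < i.rev := by omega
        have hk2 : k < rs.length := by omega
        refine ⟨(⟨k, hk2⟩ : Fin rs.length).rev, ?_, by simp⟩
        show i < _
        rw [← Fin.rev_lt_rev]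
        simpa [Fin.lt_def] using hk1
    rw [hset] at hy ⊢
    have h := hr.toIsWeaklyRegular.regular_mod_prev i.rev i.rev.2
    have e : (Ideal.ofList (rs.take (i.rev : ℕ)) • ⊤ : Submodule R R) =
        Ideal.ofList (rs.take (i.rev : ℕ)) := by simp
    rw [e] at h
    have h2 := @h (Submodule.Quotient.mk y) 0 (by
      simp only [smul_zero]
      rw [← Submodule.Quotient.mk_smul, Submodule.Quotient.mk_eq_zero]
      exact hy)
    rwa [Submodule.Quotient.mk_eq_zero] at h2

theorem q_data {R : Type*} [CommRing R] [IsLocalRing R] (hreg : IsRegularLocal R)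
    (p : ℕ) [Fact p.Prime] [CharP R p]
    (hF : Module.Finite (↥(frobenius R p).range) R) (e : ℕ) :
    ∃ (d r : ℕ) (x : Fin d → R) (v : Fin r → R), (∀ i, x i ∈ IsLocalRing.maximalIdeal R) ∧
      QSpan (Sum.elim x v) (p ^ e) ∧
      QInd (IsLocalRing.maximalIdeal R) (Sum.elim (fun _ => 1) (fun _ => 0)) (Sum.elim x v)
        (p ^ e) := by
  obtain ⟨d, x, hx, hxr⟩ := reg_data R hreg
  obtain ⟨r, v, hv1, hv2⟩ := pb_local R p hF
  have hqr : ∀ (n : ℕ) (F : MvPolynomial (Fin d) R), F.IsHomogeneous n →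
      MvPolynomial.eval x F ∈ IsLocalRing.maximalIdeal R ^ (n + 1) →
      ∀ s, MvPolynomial.coeff s F ∈ IsLocalRing.maximalIdeal R := by
    intro n F hF h s
    rw [← hx] at h ⊢
    exact qr_red x (fun F hF h s => qr_main d x hxr n F hF h s) F hF h s
  refine ⟨d, r, x, v, fun i => hx ▸ Ideal.subset_span (Set.mem_range_self i), ?_, ?_⟩
  · exact QSpan.pow p _ (qspan_of p x v (gen_p p hF x hx v hv1)) e
  · exact QInd.pow _ _ p _ (qind_of _ p x v (kp_main p _ x hx hqr v hv2)) e

theorem q_uniq {R ι : Type*} [CommRing R] [IsLocalRing R] [IsNoetherianRing R] [Fintype ι]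
    [DecidableEq ι] (p : ℕ) [Fact p.Prime] [CharP R p] (e : ℕ) (w : ι → ℕ) (z : ι → R)
    (h : QInd (IsLocalRing.maximalIdeal R) w z (p ^ e)) (c c' : (ι → Fin (p ^ e)) → R)
    (hc : ∑ γ, c γ ^ (p ^ e) * mon z (fun i => (γ i : ℕ)) =
      ∑ γ, c' γ ^ (p ^ e) * mon z (fun i => (γ i : ℕ))) : c = c' := by
  funext γ
  rw [← sub_eq_zero, ← Ideal.mem_bot,
    ← Ideal.iInf_pow_eq_bot_of_isLocalRing (IsLocalRing.maximalIdeal R)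
      (IsLocalRing.maximalIdeal.isMaximal R).ne_top, Ideal.mem_iInf]
  intro s
  refine Ideal.pow_le_pow_right (Nat.le_succ s) ?_
  refine h _ (fun γ => c γ - c' γ) ?_ γ s (Nat.lt_succ_self _)
  have : ∑ γ, (c γ - c' γ) ^ (p ^ e) * ∏ i, z i ^ (γ i : ℕ) = 0 := by
    rw [← sub_eq_zero] at hc
    rw [← hc, ← Finset.sum_sub_distrib]
    refine Finset.sum_congr rfl fun γ _ => ?_
    rw [sub_pow_char_pow, sub_mul]
    rfl
  rw [this]
  exact zero_mem _

theorem nuQ_attained {R : Type*} [CommRing R] [IsLocalRing R] {q : ℕ} {f : R} {N : ℕ}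
    (h : nuQ R q f = (N : ℕ∞)) :
    (∃ lam : R, f - lam ^ q ∈ IsLocalRing.maximalIdeal R ^ N) ∧
    ∀ lam : R, f - lam ^ q ∉ IsLocalRing.maximalIdeal R ^ (N + 1) := by
  constructor
  · by_contra hcon
    push Not at hcon
    rcases Nat.eq_zero_or_pos N with rfl | hN
    · exact hcon 0 (by simp)
    have : nuQ R q f ≤ ((N - 1 : ℕ) : ℕ∞) := by
      refine sSup_le ?_
      rintro _ ⟨k, rfl, lam, hlam⟩
      have : k < N := by
        by_contra hk
        exact hcon lam (Ideal.pow_le_pow_right (not_lt.mp hk) hlam)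
      exact_mod_cast Nat.le_sub_one_of_lt this
    rw [h] at this
    have : N ≤ N - 1 := by exact_mod_cast this
    omega
  · intro lam hlam
    have : ((N + 1 : ℕ) : ℕ∞) ≤ nuQ R q f := le_sSup ⟨N + 1, rfl, lam, hlam⟩
    rw [h] at this
    have : N + 1 ≤ N := by exact_mod_cast this
    omega

theorem eta_lower {R : Type*} [CommRing R] [IsLocalRing R] (p : ℕ) [Fact p.Prime] [CharP R p]
    (e : ℕ) (f lam : R) (N : ℕ) (h : f - lam ^ p ^ e ∈ IsLocalRing.maximalIdeal R ^ N) :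
    (N : ℕ∞) ≤ etaF R (p ^ e) f := by
  refine le_iInf₂ fun i hi => ?_
  rw [Finset.mem_Icc] at hi
  have hle : ((N - i : ℕ) : ℕ∞) ≤ ordIdeal R (diffIdealPlus R i f) := by
    refine le_sSup ⟨N - i, rfl, ?_⟩
    rw [diffIdealPlus, Ideal.span_le]
    rintro _ ⟨D, hD, hD1, rfl⟩
    have h1 := IsDiffOp.pow_linear p e (by omega) hD lam 1
    rw [mul_one, hD1, mul_zero] at h1
    have h2 := IsDiffOp.mem_pow (IsLocalRing.maximalIdeal R) hD N _ h
    rwa [map_sub, h1, sub_zero] at h2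
  calc (N : ℕ∞) ≤ ((N - i + i : ℕ) : ℕ∞) := by exact_mod_cast (by omega)
    _ = ((N - i : ℕ) : ℕ∞) + i := by push_cast; rfl
    _ ≤ _ := by gcongr

/-- Lower the `i`-th exponent by `n`. -/
def shrinkExp {ι : Type*} [DecidableEq ι] {q : ℕ} (i : ι) (n : ℕ) (γ : ι → Fin q) : ι → Fin q :=
  fun j => ⟨(γ j : ℕ) - (if j = i then n else 0), lt_of_le_of_lt (Nat.sub_le _ _) (γ j).2⟩

theorem shrinkExp_coe {ι : Type*} [DecidableEq ι] {q : ℕ} (i : ι) (n : ℕ) (γ : ι → Fin q) :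
    (fun j => ((shrinkExp i n γ j : Fin q) : ℕ)) = (fun j => (γ j : ℕ)) - Pi.single i n := by
  funext j
  simp [shrinkExp, Pi.single_apply]

theorem shrinkExp_inj {ι : Type*} [DecidableEq ι] {q : ℕ} (i : ι) (n : ℕ) (γ γ' : ι → Fin q)
    (h : n ≤ γ i) (h' : n ≤ γ' i) (e : shrinkExp i n γ = shrinkExp i n γ') : γ = γ' := by
  funext j
  have := congrArg (fun g => (g j : ℕ)) e
  simp only [shrinkExp] at this
  ext
  by_cases hj : j = i
  · subst hj
    simp at this
    omega
  · simpa [hj] using this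

theorem hasse_coeff {R ι : Type*} [CommRing R] [Fintype ι] [DecidableEq ι]
    (p : ℕ) [hp : Fact p.Prime] [CharP R p] (e : ℕ) (m : Ideal R) (w : ι → ℕ) (z : ι → R)
    (hI : QInd m w z (p ^ e)) (i : ι) (D : R →+ R) (n : ℕ)
    (hD : ∀ (t : R) (γ : ι → ℕ), D (t ^ (p ^ e) * mon z γ) =
      t ^ (p ^ e) * (((γ i).choose n : R) * mon z (γ - Pi.single i n)))
    (c : (ι → Fin (p ^ e)) → R) (k s : ℕ)
    (hk : D (∑ γ, c γ ^ (p ^ e) * mon z (fun i => (γ i : ℕ))) ∈ m ^ k)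
    (γ : ι → Fin (p ^ e)) (hn : n ≤ γ i)
    (hs : p ^ e * s + ∑ j, w j * (shrinkExp i n γ j : ℕ) < k) :
    (((γ i : ℕ).choose n : ℕ) : R) * c γ ∈ m ^ (s + 1) := by
  classical
  set S : Finset (ι → Fin (p ^ e)) := Finset.univ.filter fun γ => n ≤ γ i with hS
  let c' : (ι → Fin (p ^ e)) → R := fun δ =>
    ∑ γ ∈ S with shrinkExp i n γ = δ, (((γ i : ℕ).choose n : ℕ) : R) * c γ
  have hsum : ∑ δ, c' δ ^ (p ^ e) * mon z (fun j => (δ j : ℕ)) =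
      D (∑ γ, c γ ^ (p ^ e) * mon z (fun i => (γ i : ℕ))) := by
    rw [map_sum]
    have h1 : ∑ γ, D (c γ ^ (p ^ e) * mon z (fun i => (γ i : ℕ))) =
        ∑ γ ∈ S, D (c γ ^ (p ^ e) * mon z (fun i => (γ i : ℕ))) := by
      symm
      refine Finset.sum_subset (Finset.subset_univ _) fun γ _ hγ => ?_
      have : (γ i : ℕ) < n := by simpa [hS] using hγ
      rw [hD, Nat.choose_eq_zero_of_lt this]
      simp
    rw [h1, ← Finset.sum_fiberwise S (shrinkExp i n)]
    refine Finset.sum_congr rfl fun δ _ => ?_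
    simp only [c']
    rw [sum_pow_char_pow, Finset.sum_mul]
    refine Finset.sum_congr rfl fun γ hγ => ?_
    have hγ' : shrinkExp i n γ = δ := (Finset.mem_filter.mp hγ).2
    rw [hD, ← shrinkExp_coe, hγ', mul_pow]
    have : ((((γ i : ℕ).choose n : ℕ) : R)) ^ (p ^ e) = (((γ i : ℕ).choose n : ℕ) : R) := by
      have := map_natCast (iterateFrobenius R p e) ((γ i : ℕ).choose n)
      rwa [iterateFrobenius_def] at this
    rw [this]
    ring
  have h2 := hI k c' (by rw [← hsum] at hk; exact hk) (shrinkExp i n γ) s hs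
  have h3 : c' (shrinkExp i n γ) = (((γ i : ℕ).choose n : ℕ) : R) * c γ := by
    simp only [c']
    refine Finset.sum_eq_single_of_mem γ (by simp [hS, hn]) fun γ' hγ' hne => ?_
    exfalso
    apply hne
    simp only [hS, Finset.mem_filter, Finset.mem_univ, true_and] at hγ'
    exact shrinkExp_inj i n _ _ hγ'.1 hn hγ'.2
  rwa [h3] at h2

theorem mon_mem {R ι : Type*} [CommRing R] [Fintype ι] (m : Ideal R) (w : ι → ℕ) (z : ι → R)
    (hz : ∀ i, z i ∈ m ^ w i) (γ : ι → ℕ) : mon z γ ∈ m ^ (∑ i, w i * γ i) := by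
  rw [mon, ← Finset.prod_pow_eq_pow_sum]
  refine Ideal.prod_mem_prod fun i _ => ?_
  rw [pow_mul]
  exact Ideal.pow_mem_pow (hz i) _

theorem eta_upper {R ι : Type*} [CommRing R] [IsLocalRing R] [IsNoetherianRing R] [Fintype ι]
    [DecidableEq ι] (p : ℕ) [hp : Fact p.Prime] [CharP R p] (e : ℕ) (w : ι → ℕ) (z : ι → R)
    (hw : ∀ i, w i = 0 ∨ w i = 1) (hz : ∀ i, z i ∈ IsLocalRing.maximalIdeal R ^ w i)
    (hS : QSpan z (p ^ e)) (hI : QInd (IsLocalRing.maximalIdeal R) w z (p ^ e))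
    (f : R) (N a : ℕ) (hN : N < p ^ e * (a + 1))
    (hf : ∀ lam : R, f - lam ^ p ^ e ∉ IsLocalRing.maximalIdeal R ^ (N + 1)) :
    etaF R (p ^ e) f < ((p ^ e * (a + 1) : ℕ) : ℕ∞) := by
  classical
  set m := IsLocalRing.maximalIdeal R with hm
  have hq0 : 0 < p ^ e := pow_pos hp.out.pos e
  obtain ⟨c, hc⟩ := hS f
  -- a bad exponent
  obtain ⟨γ, hγ0, hγ⟩ : ∃ γ : ι → Fin (p ^ e), (∃ i, (γ i : ℕ) ≠ 0) ∧
      c γ ^ p ^ e * mon z (fun i => (γ i : ℕ)) ∉ m ^ (N + 1) := by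
    by_contra hcon
    push Not at hcon
    apply hf (c fun _ => ⟨0, hq0⟩)
    rw [hc, ← Finset.add_sum_erase _ _ (Finset.mem_univ (fun _ : ι => (⟨0, hq0⟩ : Fin (p ^ e))))]
    simp only [pow_zero, Finset.prod_const_one, mul_one, add_sub_cancel_left]
    refine Ideal.sum_mem _ fun γ hγ => hcon γ ?_
    by_contra h0
    push Not at h0
    exact (Finset.mem_erase.mp hγ).1 (funext fun i => Fin.ext (h0 i))
  -- the order of the coefficient
  have hex : ∃ s, c γ ∉ m ^ (s + 1) := by
    by_contra hcon
    push Not at hcon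
    apply hγ
    refine Ideal.mul_mem_right _ _ ?_
    exact Ideal.pow_mem_of_mem _ (hcon N) _ hq0
  set s := Nat.find hex with hs
  have hs1 : c γ ∉ m ^ (s + 1) := Nat.find_spec hex
  have hs2 : c γ ∈ m ^ s := by
    rcases Nat.eq_zero_or_pos s with h | h
    · rw [h]; simp
    · have := Nat.find_min hex (m := s - 1) (by omega)
      rw [Nat.sub_add_cancel h] at this
      exact not_not.mp this
  have hle : p ^ e * s + ∑ i, w i * (γ i : ℕ) ≤ N := by
    by_contra hlt
    apply hγ
    refine Ideal.pow_le_pow_right (not_le.mp hlt) ?_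
    rw [pow_add, mul_comm (p ^ e), pow_mul]
    exact Ideal.mul_mem_mul (Ideal.pow_mem_pow hs2 _) (mon_mem m w z hz _)
  -- the general bound
  have main : ∀ (i : ι) (n : ℕ), n ≠ 0 → n ≤ (γ i : ℕ) → ¬ p ∣ (γ i : ℕ).choose n →
      etaF R (p ^ e) f ≤
        ((p ^ e * s + ∑ j, w j * (shrinkExp i n γ j : ℕ) + n : ℕ) : ℕ∞) := by
    intro i n hn0 hn hdvd
    have hnq : n < p ^ e := lt_of_le_of_lt hn (γ i).2
    obtain ⟨D, hD⟩ := hasse_def p e z hS (q_uniq p e w z hI) i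
    have hord := hasse_order (p ^ e) z hS i D hD n hnq
    have hD1 : D n 1 = 0 := by
      have := hD n hnq 1 0
      rw [Pi.zero_apply, Nat.choose_eq_zero_of_lt (Nat.pos_of_ne_zero hn0)] at this
      simpa [mon] using this
    refine (iInf₂_le n (Finset.mem_Icc.mpr ⟨by omega, by omega⟩)).trans ?_
    rw [Nat.cast_add _ n]
    gcongr
    refine sSup_le ?_
    rintro _ ⟨k, rfl, hk⟩
    by_contra hlt
    have hlt' : p ^ e * s + ∑ j, w j * (shrinkExp i n γ j : ℕ) < k := by
      rw [not_le] at hlt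
      exact_mod_cast hlt
    have hmem : D n f ∈ m ^ k := hk (Ideal.subset_span ⟨D n, hord, hD1, rfl⟩)
    rw [hc] at hmem
    have h4 := hasse_coeff p e m w z hI i (D n) n (hD n hnq) c k s hmem γ hn hlt'
    have hu : IsUnit ((((γ i : ℕ).choose n : ℕ) : R)) := by
      have hcop : Nat.Coprime ((γ i : ℕ).choose n) p :=
        ((Nat.Prime.coprime_iff_not_dvd hp.out).mpr hdvd).symm
      have := ((ZMod.isUnit_iff_coprime _ p).mpr hcop).map (ZMod.castHom (dvd_refl p) R)
      simpa using this
    exact hs1 ((Ideal.unit_mul_mem_iff_mem _ hu).mp h4)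
  by_cases hcase : ∃ i, (γ i : ℕ) ≠ 0 ∧ w i = 1
  · obtain ⟨i, hi, hwi⟩ := hcase
    obtain ⟨l, hl, hd⟩ := exists_choose_ne p _ hi
    refine (main i (p ^ l) (pow_pos hp.out.pos l).ne' hl hd).trans_lt ?_
    have hsum : ∑ j, w j * (shrinkExp i (p ^ l) γ j : ℕ) + p ^ l = ∑ j, w j * (γ j : ℕ) := by
      rw [← Finset.add_sum_erase _ _ (Finset.mem_univ i),
        ← Finset.add_sum_erase (a := i) _ (fun j => w j * (γ j : ℕ)) (Finset.mem_univ i)]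
      have : ∑ j ∈ Finset.univ.erase i, w j * (shrinkExp i (p ^ l) γ j : ℕ) =
          ∑ j ∈ Finset.univ.erase i, w j * (γ j : ℕ) := by
        refine Finset.sum_congr rfl fun j hj => ?_
        simp [shrinkExp, (Finset.mem_erase.mp hj).1]
      rw [this, hwi]
      simp only [shrinkExp, if_true]
      omega
    have : p ^ e * s + ∑ j, w j * (shrinkExp i (p ^ l) γ j : ℕ) + p ^ l < p ^ e * (a + 1) := by
      omega
    exact_mod_cast this
  · push Not at hcase
    obtain ⟨i, hi⟩ := hγ0
    obtain ⟨l, hl, hd⟩ := exists_choose_ne p _ hi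
    refine (main i (p ^ l) (pow_pos hp.out.pos l).ne' hl hd).trans_lt ?_
    have hsum : ∑ j, w j * (shrinkExp i (p ^ l) γ j : ℕ) = 0 := by
      refine Finset.sum_eq_zero fun j _ => ?_
      rcases hw j with h | h
      · rw [h, zero_mul]
      · have h0 : (γ j : ℕ) = 0 := by
          by_contra h0
          exact hcase j h0 h
        simp [shrinkExp, h0]
    have hsa : s ≤ a := by
      have : p ^ e * s < p ^ e * (a + 1) := by omega
      have := Nat.lt_of_mul_lt_mul_left this
      omega
    have h5 : p ^ e * s ≤ p ^ e * a := Nat.mul_le_mul_left _ hsa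
    have h6 : p ^ l < p ^ e := lt_of_le_of_lt hl (γ i).2
    have : p ^ e * s + ∑ j, w j * (shrinkExp i (p ^ l) γ j : ℕ) + p ^ l < p ^ e * (a + 1) := by
      rw [hsum, mul_add]
      omega
    exact_mod_cast this

/-- In an `F`-finite regular local ring of characteristic `p > 0`, `q = p ^ e`, if
`ν^{(q)}(f)` is finite and equal to `q a + b` with `0 ≤ b < q`, then
`ν^{(q)}(f) ≤ η(f) < q (a + 1)`. -/
theorem nuQ_le_etaF_lt_q_mul_succ
    (R : Type*) [CommRing R] [IsDomain R] [IsLocalRing R] (hreg : IsRegularLocal R)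
    (p : ℕ) [Fact p.Prime] [CharP R p]
    (hF : Module.Finite (↥(frobenius R p).range) R)
    (e q : ℕ) (hq : q = p ^ e) (f : R) (a b : ℕ) (hb : b < q)
    (hnu : nuQ R q f = ((q * a + b : ℕ) : ℕ∞)) :
    ((q * a + b : ℕ) : ℕ∞) ≤ etaF R q f ∧ etaF R q f < ((q * (a + 1) : ℕ) : ℕ∞) := by
  subst hq
  have : IsNoetherianRing R := hreg.1
  obtain ⟨⟨lam, hlam⟩, hmax⟩ := nuQ_attained hnu
  refine ⟨eta_lower p e f lam _ hlam, ?_⟩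
  obtain ⟨d, r, x, v, hx, hS, hI⟩ := q_data hreg p hF e
  refine eta_upper p e _ _ ?_ ?_ hS hI f _ a ?_ hmax
  · rintro (i | i) <;> simp
  · rintro (i | i)
    · simpa using hx i
    · simp
  · rw [mul_add]
    omega
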